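/- arXiv:2407.19212 — 7 statements merged into one kernel-verified Lean document; each statement's English description precedes it below -/
import Mathlib

section
/- (Perfect hiding of the Pedersen vector commitment.) Assume additionally that G is finite with cardinality p and that g₀ generates G (every element of G is an F-multiple of g₀). Then for every message u ∈ F^n the map o ↦ Commit(u, o) = o • g₀ + ∑_{i=1}^n u_i • g_i is a bijection from F to G; consequently, if o is drawn from the uniform probability mass function on F, the distribution of Commit(u, o) is the uniform probability mass function on G, and in particular for any two messages u, u' ∈ F^n the distributions of Commit(u, o) and Commit(u', o) (over uniform o) are equal. -/
/-- A bijection between finite types pushes the uniform distribution forward to the uniform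
distribution. -/
theorem PMF.map_uniformOfFintype_of_bijective {α β : Type*} [Fintype α] [Nonempty α]
    [Fintype β] [Nonempty β] {f : α → β} (hf : Function.Bijective f) :
    (PMF.uniformOfFintype α).map f = PMF.uniformOfFintype β := by
  classical
  ext b
  obtain ⟨a, rfl⟩ := hf.surjective b
  rw [PMF.map_apply, tsum_eq_single a fun a' ha' => if_neg fun h => ha' (hf.injective h).symm]
  simp [Fintype.card_of_bijective hf]

/-- Perfect hiding of the Pedersen vector commitment: if `G` is finite of cardinality
`p` and `g₀` generates `G`, then for every message `u` the map
`o ↦ o • g₀ + ∑ i, u i • g i` is a bijection `F → G`; hence the pushforward of the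
uniform distribution on `F` along the commitment map is the uniform distribution on
`G`, and in particular any two messages induce the same commitment distribution. -/
theorem pedersen_commit_perfect_hiding
    (p : ℕ) [Fact p.Prime]
    (G : Type*) [AddCommGroup G] [Module (ZMod p) G]
    [Fintype G] [Nonempty G]
    (hcard : Fintype.card G = p)
    (n : ℕ) (g₀ : G) (g : Fin n → G)
    (hgen : ∀ x : G, ∃ a : ZMod p, a • g₀ = x) :
    (∀ u : Fin n → ZMod p,
        Function.Bijective (fun o : ZMod p => o • g₀ + ∑ i, u i • g i))
    ∧ (∀ u : Fin n → ZMod p,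
        PMF.map (fun o : ZMod p => o • g₀ + ∑ i, u i • g i)
            (PMF.uniformOfFintype (ZMod p))
          = PMF.uniformOfFintype G)
    ∧ (∀ u u' : Fin n → ZMod p,
        PMF.map (fun o : ZMod p => o • g₀ + ∑ i, u i • g i)
            (PMF.uniformOfFintype (ZMod p))
          = PMF.map (fun o : ZMod p => o • g₀ + ∑ i, u' i • g i)
            (PMF.uniformOfFintype (ZMod p))) := by
  have hbij (u : Fin n → ZMod p) :
      Function.Bijective (fun o : ZMod p => o • g₀ + ∑ i, u i • g i) := by
    have hsmul : Function.Bijective (fun a : ZMod p => a • g₀) :=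
      (Fintype.bijective_iff_surjective_and_card _).2 ⟨hgen, by rw [ZMod.card, hcard]⟩
    exact (Equiv.addRight (∑ i, u i • g i)).bijective.comp hsmul
  have hmap (u : Fin n → ZMod p) := PMF.map_uniformOfFintype_of_bijective (hbij u)
  exact ⟨hbij, hmap, fun u u' => (hmap u).trans (hmap u').symm⟩
end

section
/- (Algebraic soundness of the Π_ss verification equation.) Assume a ∈ F with a ≠ 0 and that e is nondegenerate with respect to g₂, i.e., for every v ∈ G₁, e(v, g₂) = 0 implies v = 0. If x : Fin l → G₁, k : Fin l → F, and π ∈ G₁ satisfy the verification equation ∑_{i} e(x_i, (a * k_i) • g₂) = e(π, a • g₂), then ∑_{i} k_i • x_i = π. -/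
/-- Algebraic soundness of the `Π_ss` verification equation: if `a ≠ 0`, the pairing
`e` is nondegenerate with respect to `g₂`, and the verification equation
`∑ i, e (x i) ((a * k i) • g₂) = e π (a • g₂)` holds, then `∑ i, k i • x i = π`. -/
theorem pi_ss_soundness
    (p : ℕ) [Fact p.Prime]
    (G₁ G₂ GT : Type*)
    [AddCommGroup G₁] [Module (ZMod p) G₁]
    [AddCommGroup G₂] [Module (ZMod p) G₂]
    [AddCommGroup GT] [Module (ZMod p) GT]
    (e : G₁ →ₗ[ZMod p] G₂ →ₗ[ZMod p] GT)
    (g₂ : G₂)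
    (hnondeg : ∀ v : G₁, e v g₂ = 0 → v = 0)
    (a : ZMod p) (ha : a ≠ 0)
    (l : ℕ) (x : Fin l → G₁) (k : Fin l → ZMod p) (π : G₁)
    (hver : ∑ i, e (x i) ((a * k i) • g₂) = e π (a • g₂)) :
    ∑ i, k i • x i = π := by
  have hscaled : a • e (∑ i, k i • x i) g₂ = a • e π g₂ := by
    simpa [Finset.smul_sum, LinearMap.sum_apply, mul_smul] using hver
  refine sub_eq_zero.mp (hnondeg _ ?_)
  rw [map_sub, LinearMap.sub_apply, sub_eq_zero]
  exact (IsUnit.mk0 a ha).smul_left_cancel.mp hscaled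
end

section
/- (The key polynomial identity of the Bulletproofs arithmetic-circuit protocol.) Assume the circuit constraints hold: a_L,i * a_R,i = a_O,i for all i, and for every q, ∑_i (W_L[q,i] * a_L,i + W_R[q,i] * a_R,i + W_O[q,i] * a_O,i) = ∑_j W_V[q,j] * v_j + c_q. Then the polynomial t(X) = ∑_{i=0}^{n-1} l_i(X) * r_i(X) ∈ F[X] satisfies: (a) its constant coefficient is 0; (b) its degree is at most 6; and (c) its coefficient of X² equals δ(y, z) + ∑_{q=0}^{Q-1} z^{q+1} * (c_q + ∑_{j=0}^{m-1} W_V[q,j] * v_j), where δ(y, z) = ∑_{i=0}^{n-1} (y⁻¹)^i * (z^T W_R)_i * (z^T W_L)_i. -/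
open Polynomial

/-- The coefficients of a product of two cubics, the first without constant term and the second
without quadratic term. -/
theorem cubic_mul_cubic_expand {R : Type*} [CommRing R] (a b d e f g : R) :
    (C a * X + C b * X ^ 2 + C d * X ^ 3) * (C e + C f * X + C g * X ^ 3)
      = C (a * e) * X ^ 1 + C (a * f + b * e) * X ^ 2 + C (b * f + d * e) * X ^ 3
        + C (a * g + d * f) * X ^ 4 + C (b * g) * X ^ 5 + C (d * g) * X ^ 6 := by
  simp only [C_add, C_mul]
  ring

/-- Weighting the rows of a matrix-vector product is the same as weighting the columns first. -/
theorem sum_weighted_rows {R ι κ : Type*} [CommSemiring R] [Fintype ι] [Fintype κ]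
    (w : κ → R) (W : κ → ι → R) (x : ι → R) :
    ∑ q, w q * ∑ i, W q i * x i = ∑ i, (∑ q, w q * W q i) * x i := by
  simp only [Finset.mul_sum, Finset.sum_mul, mul_assoc]
  exact Finset.sum_comm

/-- The key polynomial identity of the Bulletproofs arithmetic-circuit protocol:
if the multiplication constraints `a_L ∘ a_R = a_O` and the linear constraints
`W_L·a_L + W_R·a_R + W_O·a_O = W_V·v + c` hold, then `t(X) = ⟨l(X), r(X)⟩`
has zero constant coefficient, degree at most `6`, and its `X²`-coefficient equals
`δ(y,z) + ∑ q, z^(q+1) * (c_q + (W_V·v)_q)`. -/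
theorem bulletproofs_t_poly_identity
    (p : ℕ) [Fact p.Prime]
    (n Q m : ℕ)
    (aL aR aO sL sR : Fin n → ZMod p)
    (WL WR WO : Fin Q → Fin n → ZMod p)
    (WV : Fin Q → Fin m → ZMod p)
    (v : Fin m → ZMod p) (c : Fin Q → ZMod p)
    (y z : ZMod p) (hy : y ≠ 0)
    (hmul : ∀ i, aL i * aR i = aO i)
    (hlin : ∀ q, (∑ i, (WL q i * aL i + WR q i * aR i + WO q i * aO i))
        = (∑ j, WV q j * v j) + c q)
    (zWL zWR zWO : Fin n → ZMod p)
    (hzWL : ∀ i, zWL i = ∑ q : Fin Q, z ^ ((q : ℕ) + 1) * WL q i)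
    (hzWR : ∀ i, zWR i = ∑ q : Fin Q, z ^ ((q : ℕ) + 1) * WR q i)
    (hzWO : ∀ i, zWO i = ∑ q : Fin Q, z ^ ((q : ℕ) + 1) * WO q i)
    (l r : Fin n → Polynomial (ZMod p))
    (hl : ∀ i, l i = C (aL i + y⁻¹ ^ (i : ℕ) * zWR i) * X
        + C (aO i) * X ^ 2 + C (sL i) * X ^ 3)
    (hr : ∀ i, r i = C (-(y ^ (i : ℕ)) + zWO i)
        + C (y ^ (i : ℕ) * aR i + zWL i) * X
        + C (y ^ (i : ℕ) * sR i) * X ^ 3)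
    (t : Polynomial (ZMod p)) (ht : t = ∑ i, l i * r i) :
    t.coeff 0 = 0
    ∧ t.degree ≤ 6
    ∧ t.coeff 2
        = (∑ i : Fin n, y⁻¹ ^ (i : ℕ) * zWR i * zWL i)
          + ∑ q : Fin Q, z ^ ((q : ℕ) + 1) * (c q + ∑ j, WV q j * v j) := by
  have hlr (i : Fin n) := by
    simpa only [← hl i, ← hr i] using cubic_mul_cubic_expand
      (aL i + y⁻¹ ^ (i : ℕ) * zWR i) (aO i) (sL i) (-(y ^ (i : ℕ)) + zWO i)
      (y ^ (i : ℕ) * aR i + zWL i) (y ^ (i : ℕ) * sR i)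
  have hweighted : ∑ q : Fin Q, z ^ ((q : ℕ) + 1) * (c q + ∑ j, WV q j * v j)
      = ∑ i, (zWL i * aL i + zWR i * aR i + zWO i * aO i) := by
    simp only [add_comm (c _), ← hlin, hzWL, hzWR, hzWO, Finset.sum_add_distrib, mul_add,
      sum_weighted_rows]
  subst ht
  refine ⟨?_, ?_, ?_⟩
  · simp [hlr, coeff_X_pow]
  · refine (degree_sum_le _ _).trans (Finset.sup_le fun i _ => ?_)
    rw [hlr]
    compute_degree
  · rw [hweighted, finsetSum_coeff, ← Finset.sum_add_distrib]
    refine Finset.sum_congr rfl fun i _ => ?_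
    have hinv : y⁻¹ ^ (i : ℕ) * y ^ (i : ℕ) = 1 := by
      rw [← mul_pow, inv_mul_cancel₀ hy, one_pow]
    have hcoeff : (l i * r i).coeff 2 = (aL i + y⁻¹ ^ (i : ℕ) * zWR i)
        * (y ^ (i : ℕ) * aR i + zWL i) + aO i * (-(y ^ (i : ℕ)) + zWO i) := by
      rw [hlr]
      simp [coeff_X_pow, -map_add, -map_mul, coeff_C_mul]
    rw [hcoeff]
    linear_combination zWR i * aR i * hinv + y ^ (i : ℕ) * hmul i
end

section
/- (Completeness of the Bulletproofs verifier's main commitment check.) Define the honest prover messages A_I = α • h + ∑_i a_L,i • gv_i + ∑_i a_R,i • hv_i, A_O = β • h + ∑_i a_O,i • gv_i, S = ρ • h + ∑_i s_L,i • gv_i + ∑_i s_R,i • hv_i, and the verifier's derived elements h'_i = (y⁻¹)^i • hv_i, W_L^G = ∑_i (z^T W_L)_i • h'_i, W_R^G = ∑_i ((y⁻¹)^i * (z^T W_R)_i) • gv_i, W_O^G = ∑_i (z^T W_O)_i • h'_i, and P = x • A_I + x² • A_O + ∑_i (−y^i) • h'_i + x • W_L^G + x • W_R^G + W_O^G + x³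 • S. Let μ = α*x + β*x² + ρ*x³, and let l, r : Fin n → F be the evaluations l_i = x * a_L,i + x² * a_O,i + x * (y⁻¹)^i * (z^T W_R)_i + x³ * s_L,i and r_i = x * y^i * a_R,i − y^i + (x * (z^T W_L)_i + (z^T W_O)_i) + x³ * y^i * s_R,i. Then P = μ • h + ∑_i l_i • gv_i + ∑_i r_i • h'_i; equivalently, P − μ • h + (x_u * ⟨l, r⟩) • g equals ∑_i l_i • gv_i + ∑_i r_i • h'_i + ⟨l, r⟩ • (x_u • g) for any x_u ∈ F and g ∈ G, where ⟨l, r⟩ = ∑_i l_i * r_i. -/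
/-- Completeness of the Bulletproofs verifier's main commitment check: the verifier's
derived element `P` equals `μ • h + ∑ i, l i • gv i + ∑ i, r i • h' i` for the honest
prover's messages, and equivalently
`P - μ • h + (x_u * ⟨l, r⟩) • g = ∑ i, l i • gv i + ∑ i, r i • h' i + ⟨l, r⟩ • (x_u • g)`. -/
theorem bulletproofs_commitment_check_complete
    (p : ℕ) [Fact p.Prime]
    (G : Type*) [AddCommGroup G] [Module (ZMod p) G]
    (n Q : ℕ) (h g : G) (gv hv : Fin n → G)
    (y z x xu : ZMod p) (hy : y ≠ 0)
    (α β ρ : ZMod p)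
    (aL aR aO sL sR : Fin n → ZMod p)
    (WL WR WO : Fin Q → Fin n → ZMod p)
    (zWL zWR zWO : Fin n → ZMod p)
    (hzWL : ∀ i, zWL i = ∑ q : Fin Q, z ^ ((q : ℕ) + 1) * WL q i)
    (hzWR : ∀ i, zWR i = ∑ q : Fin Q, z ^ ((q : ℕ) + 1) * WR q i)
    (hzWO : ∀ i, zWO i = ∑ q : Fin Q, z ^ ((q : ℕ) + 1) * WO q i)
    (AI AO S : G)
    (hAI : AI = α • h + (∑ i, aL i • gv i) + ∑ i, aR i • hv i)
    (hAO : AO = β • h + ∑ i, aO i • gv i)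
    (hS : S = ρ • h + (∑ i, sL i • gv i) + ∑ i, sR i • hv i)
    (h' : Fin n → G) (hh' : ∀ i, h' i = y⁻¹ ^ (i : ℕ) • hv i)
    (WLG WRG WOG : G)
    (hWLG : WLG = ∑ i, zWL i • h' i)
    (hWRG : WRG = ∑ i : Fin n, (y⁻¹ ^ (i : ℕ) * zWR i) • gv i)
    (hWOG : WOG = ∑ i, zWO i • h' i)
    (P : G)
    (hP : P = x • AI + (x ^ 2) • AO + (∑ i : Fin n, (-(y ^ (i : ℕ))) • h' i)
        + x • WLG + x • WRG + WOG + (x ^ 3) • S)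
    (μ : ZMod p) (hμ : μ = α * x + β * x ^ 2 + ρ * x ^ 3)
    (l r : Fin n → ZMod p)
    (hl : ∀ i, l i = x * aL i + x ^ 2 * aO i
        + x * (y⁻¹ ^ (i : ℕ) * zWR i) + x ^ 3 * sL i)
    (hr : ∀ i, r i = x * y ^ (i : ℕ) * aR i - y ^ (i : ℕ)
        + (x * zWL i + zWO i) + x ^ 3 * (y ^ (i : ℕ) * sR i)) :
    P = μ • h + (∑ i, l i • gv i) + ∑ i, r i • h' i
    ∧ P - μ • h + (xu * ∑ i, l i * r i) • g
        = (∑ i, l i • gv i) + (∑ i, r i • h' i)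
          + (∑ i, l i * r i) • (xu • g) := by
  have hhv : ∀ i, hv i = y ^ (i : ℕ) • h' i := fun i ↦ by
    rw [hh', smul_smul, ← mul_pow, mul_inv_cancel₀ hy, one_pow, one_smul]
  have hlsum : ∑ i, l i • gv i = x • (∑ i, aL i • gv i) + x ^ 2 • (∑ i, aO i • gv i)
      + x • WRG + x ^ 3 • (∑ i, sL i • gv i) := by
    simp only [hWRG, Finset.smul_sum, ← Finset.sum_add_distrib]
    refine Finset.sum_congr rfl fun i _ ↦ ?_
    rw [hl]
    module
  have hrsum : ∑ i, r i • h' i = x • (∑ i, aR i • hv i)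
      + (∑ i : Fin n, (-(y ^ (i : ℕ))) • h' i) + x • WLG + WOG
      + x ^ 3 • (∑ i, sR i • hv i) := by
    simp only [hWLG, hWOG, Finset.smul_sum, ← Finset.sum_add_distrib]
    refine Finset.sum_congr rfl fun i _ ↦ ?_
    rw [hr, hhv]
    module
  have hcommit : P = μ • h + (∑ i, l i • gv i) + ∑ i, r i • h' i := by
    rw [hlsum, hrsum, hP, hAI, hAO, hS, hμ]
    module
  refine ⟨hcommit, ?_⟩
  rw [hcommit]
  module
end

section
/- (One-round folding identity of the inner-product argument.) Let x ∈ F with x ≠ 0. Define c_L = ⟨a_lo, b_hi⟩, c_R = ⟨a_hi, b_lo⟩, L = ∑_i a_lo,i • g_hi,i + ∑_i b_hi,i • h_lo,i + c_L • u, R = ∑_i a_hi,i • g_lo,i + ∑_i b_lo,i • h_hi,i + c_R • u, and P = ∑_i a_lo,i • g_lo,i + ∑_i a_hi,i • g_hi,i + ∑_i b_lo,i • h_lo,i + ∑_i b_hi,i • h_hi,i + (⟨a_lo, b_lo⟩ + ⟨a_hi, b_hi⟩) • u. Define the folded vectors a'_i = x * a_lo,i + x⁻¹ * a_hi,i, b'_i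 = x⁻¹ * b_lo,i + x * b_hi,i, g'_i = x⁻¹ • g_lo,i + x • g_hi,i, h'_i = x • h_lo,i + x⁻¹ • h_hi,i. Then ∑_i a'_i • g'_i + ∑_i b'_i • h'_i + ⟨a', b'⟩ • u = x² • L + P + x⁻² • R. -/
/-- Expansion of the pairing of two vectors folded with inverse weights. -/
theorem sum_smul_of_eq_fold {ι F M : Type*} [Fintype ι] [Field F] [AddCommGroup M] [Module F M]
    {x : F} (hx : x ≠ 0) {a b c : ι → F} {v w z : ι → M}
    (hc : ∀ i, c i = x * a i + x⁻¹ * b i) (hz : ∀ i, z i = x⁻¹ • v i + x • w i) :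
    ∑ i, c i • z i
      = x ^ 2 • ∑ i, a i • w i + (∑ i, a i • v i + ∑ i, b i • w i)
        + x⁻¹ ^ 2 • ∑ i, b i • v i := by
  simp only [hc, hz, Finset.smul_sum, ← Finset.sum_add_distrib]
  refine Finset.sum_congr rfl fun i _ => ?_
  match_scalars <;> field_simp

/-- One-round folding identity of the inner-product argument: the commitment to the
folded vectors `a', b'` with respect to the folded generators `g', h'` equals
`x² • L + P + x⁻² • R`. -/
theorem ipa_one_round_folding
    (p : ℕ) [Fact p.Prime]
    (G : Type*) [AddCommGroup G] [Module (ZMod p) G]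
    (n' : ℕ) (glo ghi hlo hhi : Fin n' → G) (u : G)
    (alo ahi blo bhi : Fin n' → ZMod p)
    (x : ZMod p) (hx : x ≠ 0)
    (cL cR : ZMod p)
    (hcL : cL = ∑ i, alo i * bhi i)
    (hcR : cR = ∑ i, ahi i * blo i)
    (L R P : G)
    (hL : L = (∑ i, alo i • ghi i) + (∑ i, bhi i • hlo i) + cL • u)
    (hR : R = (∑ i, ahi i • glo i) + (∑ i, blo i • hhi i) + cR • u)
    (hP : P = (∑ i, alo i • glo i) + (∑ i, ahi i • ghi i)
        + (∑ i, blo i • hlo i) + (∑ i, bhi i • hhi i)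
        + ((∑ i, alo i * blo i) + ∑ i, ahi i * bhi i) • u)
    (a' b' : Fin n' → ZMod p) (g' h' : Fin n' → G)
    (ha' : ∀ i, a' i = x * alo i + x⁻¹ * ahi i)
    (hb' : ∀ i, b' i = x⁻¹ * blo i + x * bhi i)
    (hg' : ∀ i, g' i = x⁻¹ • glo i + x • ghi i)
    (hh' : ∀ i, h' i = x • hlo i + x⁻¹ • hhi i) :
    (∑ i, a' i • g' i) + (∑ i, b' i • h' i) + (∑ i, a' i * b' i) • u
      = (x ^ 2) • L + P + (x⁻¹ ^ 2) • R := by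
  have hF := sum_smul_of_eq_fold hx ha' hb'
  simp only [smul_eq_mul] at hF
  rw [sum_smul_of_eq_fold hx ha' hg',
    sum_smul_of_eq_fold hx (fun i => (hb' i).trans (add_comm _ _))
      (fun i => (hh' i).trans (add_comm _ _)), hF, hL, hR, hP, hcL, hcR]
  module
end

section
/- (The s-vector formula for iterated generator folding in the inner-product argument.) Let k ∈ ℕ and g : Fin (2^k) → G, and let x : Fin k → Fˣ be units (challenges). Define the fold recursively: set g⁽⁰⁾ = g, and for j = 1, …, k, given g⁽ʲ⁻¹⁾ : Fin (2^{k-j+1}) → G, set g⁽ʲ⁾_i = x_j⁻¹ • g⁽ʲ⁻¹⁾_i + x_j • g⁽ʲ⁻¹⁾_{i + 2^{k-j}} for i ∈ Fin (2^{k-j}). For i ∈ Fin (2^k), define s_i = ∏_{j=1}^{k} (if the binary digit of i at position (k−j) is 1 then x_j else x_j⁻¹) ∈ Fˣ. Then the final folded element satisfies g⁽ᵏ⁾_0 = ∑_{i=0}^{2^k − 1} (s_i : F) • g_i. -/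
/-- The iterated generator fold of the inner-product argument: starting from
`g : Fin (2^k) → G`, round `j` (for `j = 1, …, k`) replaces the current vector
`g'` of length `2^(k-j+1)` by the vector `i ↦ x_j⁻¹ • g' i + x_j • g' (i + 2^(k-j))`
of length `2^(k-j)`; the result is the single final folded group element. -/
def ipaGenFold (p : ℕ) (G : Type*) [AddCommGroup G] [Module (ZMod p) G] :
    (k : ℕ) → (Fin (2 ^ k) → G) → (Fin k → (ZMod p)ˣ) → G
  | 0, g, _ => g ⟨0, by norm_num⟩
  | k + 1, g, x =>
      ipaGenFold p G k
        (fun i : Fin (2 ^ k) =>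
          (((x 0)⁻¹ : (ZMod p)ˣ) : ZMod p) •
              g ⟨i.1, by have := i.2; simp [pow_succ] at *; omega⟩
            + ((x 0 : (ZMod p)ˣ) : ZMod p) •
              g ⟨i.1 + 2 ^ k, by have := i.2; simp [pow_succ] at *; omega⟩)
        (fun j => x j.succ)

theorem Fin.sum_univ_two_pow_succ {M : Type*} [AddCommMonoid M] (k : ℕ)
    (f : Fin (2 ^ (k + 1)) → M) :
    ∑ i, f i = ∑ i : Fin (2 ^ k),
      (f ⟨i, by have := i.2; rw [pow_succ]; omega⟩ +
        f ⟨i + 2 ^ k, by have := i.2; rw [pow_succ]; omega⟩) := by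
  have h : 2 ^ k + 2 ^ k = 2 ^ (k + 1) := by rw [pow_succ]; omega
  rw [← (finCongr h).sum_comp f, Fin.sum_univ_add, Finset.sum_add_distrib]
  congr 1
  refine Finset.sum_congr rfl fun i _ => congrArg f (Fin.ext ?_)
  simp

/-- The contribution of the leading bit to the s-vector product, when it is `0`. -/
theorem prod_ite_testBit_succ_of_lt {M : Type*} [CommGroup M] {k i : ℕ} (hi : i < 2 ^ k)
    (x : Fin (k + 1) → M) :
    (∏ j : Fin (k + 1), if i.testBit (k + 1 - 1 - j) then x j else (x j)⁻¹) =
      (x 0)⁻¹ * ∏ j : Fin k, if i.testBit (k - 1 - j) then x j.succ else (x j.succ)⁻¹ := by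
  rw [Fin.prod_univ_succ]
  simp only [Fin.val_zero, Fin.val_succ, Nat.add_sub_cancel, Nat.sub_zero,
    Nat.testBit_lt_two_pow hi, Bool.false_eq_true, if_false, Nat.sub_sub, add_comm]

/-- The contribution of the leading bit to the s-vector product, when it is `1`. -/
theorem prod_ite_testBit_add_two_pow {M : Type*} [CommGroup M] {k i : ℕ} (hi : i < 2 ^ k)
    (x : Fin (k + 1) → M) :
    (∏ j : Fin (k + 1), if (i + 2 ^ k).testBit (k + 1 - 1 - j) then x j else (x j)⁻¹) =
      x 0 * ∏ j : Fin k, if i.testBit (k - 1 - j) then x j.succ else (x j.succ)⁻¹ := by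
  rw [Fin.prod_univ_succ, add_comm i]
  congr 1
  · simp [Nat.testBit_two_pow_add_eq, Nat.testBit_lt_two_pow hi]
  · refine Finset.prod_congr rfl fun j _ => ?_
    have hj : k + 1 - 1 - (j.succ : ℕ) = k - 1 - j := by rw [Fin.val_succ]; omega
    rw [hj, Nat.testBit_two_pow_add_gt (by have := j.2; omega)]

/-- The s-vector formula for iterated generator folding in the inner-product
argument: the final folded element equals `∑ i, s i • g i`, where
`s i = ∏_{j=1}^{k} (x j if the binary digit of i at position (k - j) is 1,
else x j⁻¹)`. -/
theorem ipa_gen_fold_eq_s_vector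
    (p : ℕ) [Fact p.Prime]
    (G : Type*) [AddCommGroup G] [Module (ZMod p) G]
    (k : ℕ) (g : Fin (2 ^ k) → G) (x : Fin k → (ZMod p)ˣ)
    (s : Fin (2 ^ k) → (ZMod p)ˣ)
    (hs : ∀ i, s i = ∏ j : Fin k,
        if Nat.testBit (i : ℕ) (k - 1 - (j : ℕ)) then x j else (x j)⁻¹) :
    ipaGenFold p G k g x = ∑ i, ((s i : (ZMod p)ˣ) : ZMod p) • g i := by
  induction k with
  | zero =>
    simp only [ipaGenFold, hs]
    simp
  | succ k ih =>
    rw [ipaGenFold, Fin.sum_univ_two_pow_succ, ih _ _ _ fun _ => rfl]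
    refine Finset.sum_congr rfl fun i _ => ?_
    rw [hs, hs, prod_ite_testBit_succ_of_lt i.2, prod_ite_testBit_add_two_pow i.2,
      smul_add, smul_smul, smul_smul, Units.val_mul, Units.val_mul, mul_comm,
      mul_comm (x 0 : ZMod p)]
end

section
/- (Completeness of the inner-product argument verifier's final check.) Let k ∈ ℕ, g, h : Fin (2^k) → G, u ∈ G, a, b : Fin (2^k) → F, and challenges x : Fin k → Fˣ. Define the joint fold recursively: (a⁽⁰⁾, b⁽⁰⁾, g⁽⁰⁾, h⁽⁰⁾) = (a, b, g, h), and for j = 1, …, k, writing n' = 2^{k-j} and splitting each length-2n' vector into its lo half (indices < n') and hi half (indices ≥ n'), set L_j = ∑_i a_lo,i • g_hi,i + ∑_i b_hi,i • h_lo,i + ⟨a_lo, b_hi⟩ • u and R_j = ∑_i a_hi,i • g_lo,i + ∑_i b_lo,i • h_hi,i + ⟨a_hi, b_lo⟩ • u (computed from the round-(j−1) vectors), and fold a⁽ʲ⁾_i = x_j * a_lo,i + x_j⁻¹ * a_hi,i, b⁽ʲ⁾_i = x_j⁻¹ * b_lo,i + x_j * b_hi,i, g⁽ʲ⁾_i =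 x_j⁻¹ • g_lo,i + x_j • g_hi,i, h⁽ʲ⁾_i = x_j • h_lo,i + x_j⁻¹ • h_hi,i. Let a_fin = a⁽ᵏ⁾_0 and b_fin = b⁽ᵏ⁾_0, and for i ∈ Fin (2^k) let s_i = ∏_{j=1}^{k} (if the binary digit of i at position (k−j) is 1 then x_j else x_j⁻¹) ∈ Fˣ. Then ∑_i (a_fin * s_i) • g_i + ∑_i (b_fin * s_i⁻¹) • h_i + (a_fin * b_fin) • u = ∑_i a_i • g_i + ∑_i b_i • h_i + ⟨a, b⟩ • u + ∑_{j=1}^{k} ((x_j² : F) • L_j + (x_j⁻² : F) • R_j). -/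
/-- The joint folding recursion of the inner-product argument: at each round the
vectors `a, b` and the generator vectors `g, h` are split into lo/hi halves, the
round messages `L, R` are computed, and all four vectors are folded using the round
challenge.  The result consists of the final scalars `a_fin, b_fin` together with
the per-round messages `L_j, R_j`. -/
def ipaJointFold (p : ℕ) (G : Type*) [AddCommGroup G] [Module (ZMod p) G] (u : G) :
    (k : ℕ) → (Fin (2 ^ k) → ZMod p) → (Fin (2 ^ k) → ZMod p) →
      (Fin (2 ^ k) → G) → (Fin (2 ^ k) → G) → (Fin k → (ZMod p)ˣ) →
      ZMod p × ZMod p × (Fin k → G) × (Fin k → G)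
  | 0, a, b, _, _, _ =>
      (a ⟨0, by norm_num⟩, b ⟨0, by norm_num⟩, Fin.elim0, Fin.elim0)
  | k + 1, a, b, g, h, x =>
      let lo : Fin (2 ^ k) → Fin (2 ^ (k + 1)) :=
        fun i => ⟨i.1, by have := i.2; simp [pow_succ] at *; omega⟩
      let hi : Fin (2 ^ k) → Fin (2 ^ (k + 1)) :=
        fun i => ⟨i.1 + 2 ^ k, by have := i.2; simp [pow_succ] at *; omega⟩
      let L : G := (∑ i, a (lo i) • g (hi i)) + (∑ i, b (hi i) • h (lo i))
        + (∑ i, a (lo i) * b (hi i)) • u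
      let R : G := (∑ i, a (hi i) • g (lo i)) + (∑ i, b (lo i) • h (hi i))
        + (∑ i, a (hi i) * b (lo i)) • u
      let res := ipaJointFold p G u k
        (fun i => ((x 0 : (ZMod p)ˣ) : ZMod p) * a (lo i)
          + (((x 0)⁻¹ : (ZMod p)ˣ) : ZMod p) * a (hi i))
        (fun i => (((x 0)⁻¹ : (ZMod p)ˣ) : ZMod p) * b (lo i)
          + ((x 0 : (ZMod p)ˣ) : ZMod p) * b (hi i))
        (fun i => (((x 0)⁻¹ : (ZMod p)ˣ) : ZMod p) • g (lo i)
          + ((x 0 : (ZMod p)ˣ) : ZMod p) • g (hi i))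
        (fun i => ((x 0 : (ZMod p)ˣ) : ZMod p) • h (lo i)
          + (((x 0)⁻¹ : (ZMod p)ˣ) : ZMod p) • h (hi i))
        (fun j => x j.succ)
      (res.1, res.2.1, Fin.cons L res.2.2.1, Fin.cons R res.2.2.2)

theorem sum_fin_two_pow_succ {M : Type*} [AddCommMonoid M] (k : ℕ) (f : Fin (2 ^ (k + 1)) → M) :
    ∑ i, f i = (∑ i : Fin (2 ^ k), f ⟨i.1, by have := i.2; rw [pow_succ]; omega⟩)
      + ∑ i : Fin (2 ^ k), f ⟨i.1 + 2 ^ k, by have := i.2; rw [pow_succ]; omega⟩ := by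
  have e : 2 ^ k + 2 ^ k = 2 ^ (k + 1) := by rw [pow_succ]; omega
  rw [← Equiv.sum_comp (finCongr e), Fin.sum_univ_add]
  congr 1
  refine Finset.sum_congr rfl fun i _ => congrArg f (Fin.ext ?_)
  simp

/-- Folding the four vectors with a challenge `x` of inverse `y` changes the commitment by
`x² • L + y² • R`. -/
theorem commitment_fold {R G ι : Type*} [CommRing R] [AddCommGroup G] [Module R G] [Fintype ι]
    (x y : R) (hxy : x * y = 1) (al ah bl bh : ι → R) (gl gh hl hh : ι → G) (u : G) :
    (∑ i, (x * al i + y * ah i) • (y • gl i + x • gh i))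
      + (∑ i, (y * bl i + x * bh i) • (x • hl i + y • hh i))
      + (∑ i, (x * al i + y * ah i) * (y * bl i + x * bh i)) • u
    = ((∑ i, al i • gl i) + ∑ i, ah i • gh i) + ((∑ i, bl i • hl i) + ∑ i, bh i • hh i)
      + ((∑ i, al i * bl i) + ∑ i, ah i * bh i) • u
      + (x ^ 2 • ((∑ i, al i • gh i) + (∑ i, bh i • hl i) + (∑ i, al i * bh i) • u)
        + y ^ 2 • ((∑ i, ah i • gl i) + (∑ i, bl i • hh i) + (∑ i, ah i * bl i) • u)) := by
  simp only [smul_add, add_smul, Finset.smul_sum, Finset.sum_smul, ← Finset.sum_add_distrib]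
  refine Finset.sum_congr rfl fun i _ => ?_
  linear_combination (norm := module) hxy • (al i • gl i + ah i • gh i + bl i • hl i + bh i • hh i
    + (al i * bl i + ah i * bh i) • u)

theorem prod_testBit_lo {M : Type*} [CommGroup M] {k : ℕ} (x : Fin (k + 1) → M)
    {i : ℕ} (hi : i < 2 ^ k) :
    (∏ j : Fin (k + 1), if i.testBit (k + 1 - 1 - (j : ℕ)) then x j else (x j)⁻¹)
      = (x 0)⁻¹ * ∏ j : Fin k,
        if i.testBit (k - 1 - (j : ℕ)) then x j.succ else (x j.succ)⁻¹ := by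
  rw [Fin.prod_univ_succ]
  congr 1
  · simp [Nat.testBit_lt_two_pow hi]
  · refine Finset.prod_congr rfl fun j _ => ?_
    rw [show k + 1 - 1 - (j.succ : ℕ) = k - 1 - (j : ℕ) by simp only [Fin.val_succ]; omega]

theorem prod_testBit_hi {M : Type*} [CommGroup M] {k : ℕ} (x : Fin (k + 1) → M)
    {i : ℕ} (hi : i < 2 ^ k) :
    (∏ j : Fin (k + 1), if (i + 2 ^ k).testBit (k + 1 - 1 - (j : ℕ)) then x j else (x j)⁻¹)
      = x 0 * ∏ j : Fin k,
        if i.testBit (k - 1 - (j : ℕ)) then x j.succ else (x j.succ)⁻¹ := by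
  rw [Fin.prod_univ_succ, add_comm i]
  congr 1
  · simp [Nat.testBit_two_pow_add_eq, Nat.testBit_lt_two_pow hi]
  · refine Finset.prod_congr rfl fun j _ => ?_
    rw [show k + 1 - 1 - (j.succ : ℕ) = k - 1 - (j : ℕ) by simp only [Fin.val_succ]; omega,
      Nat.testBit_two_pow_add_gt (by have := j.2; omega)]

/-- Completeness of the inner-product argument verifier's final check: the
commitment to the final folded scalars `a_fin, b_fin` with respect to the
`s`-vector-adjusted original generators equals the original commitment
`∑ a_i • g_i + ∑ b_i • h_i + ⟨a, b⟩ • u`, adjusted by `∑_j (x_j² • L_j + x_j⁻² • R_j)`. -/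
theorem ipa_final_check_complete
    (p : ℕ) [Fact p.Prime]
    (G : Type*) [AddCommGroup G] [Module (ZMod p) G]
    (k : ℕ) (g h : Fin (2 ^ k) → G) (u : G)
    (a b : Fin (2 ^ k) → ZMod p) (x : Fin k → (ZMod p)ˣ)
    (afin bfin : ZMod p) (Ls Rs : Fin k → G)
    (hres : ipaJointFold p G u k a b g h x = (afin, bfin, Ls, Rs))
    (s : Fin (2 ^ k) → (ZMod p)ˣ)
    (hs : ∀ i, s i = ∏ j : Fin k,
        if Nat.testBit (i : ℕ) (k - 1 - (j : ℕ)) then x j else (x j)⁻¹) :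
    (∑ i, (afin * ((s i : (ZMod p)ˣ) : ZMod p)) • g i)
      + (∑ i, (bfin * (((s i)⁻¹ : (ZMod p)ˣ) : ZMod p)) • h i)
      + (afin * bfin) • u
    = (∑ i, a i • g i) + (∑ i, b i • h i) + (∑ i, a i * b i) • u
      + ∑ j : Fin k,
          ((((x j) ^ 2 : (ZMod p)ˣ) : ZMod p) • Ls j
            + ((((x j)⁻¹) ^ 2 : (ZMod p)ˣ) : ZMod p) • Rs j) := by
  induction k generalizing afin bfin with
  | zero =>
    simp only [ipaJointFold, Prod.mk.injEq] at hres
    obtain ⟨rfl, rfl, -, -⟩ := hres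
    simp [hs]
  | succ k ih =>
    simp only [ipaJointFold, Prod.mk.injEq] at hres
    obtain ⟨ha, hb, rfl, rfl⟩ := hres
    have key := ih _ _ _ _ _ _ _ _ _ (Prod.ext ha (Prod.ext hb rfl)) _ (fun _ => rfl)
    rw [commitment_fold _ _ (Units.mul_inv (x 0))] at key
    simp only [sum_fin_two_pow_succ, Fin.sum_univ_succ, Fin.cons_zero, Fin.cons_succ, hs,
      prod_testBit_lo x (Fin.is_lt _), prod_testBit_hi x (Fin.is_lt _),
      Units.val_pow_eq_pow_val] at key ⊢
    refine Eq.trans ?_ (key.trans (add_assoc _ _ _))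
    rw [← Finset.sum_add_distrib, ← Finset.sum_add_distrib]
    congr 2
    · refine Finset.sum_congr rfl fun i _ => ?_
      simp only [Units.val_mul]
      module
    · refine Finset.sum_congr rfl fun i _ => ?_
      simp only [mul_inv, inv_inv, Units.val_mul]
      module
end
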